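/- Let {X_n, n≥1} be a φ-mixing sequence of random variables with mixing coefficients satisfying φ(n)=O(n^{-3}), and assume P(X_i = X_j) = 0 for all i ≠ j. Fix p ∈ (0,1) and assume the common marginal distribution function F possesses a positive continuous density f in a neighborhood N_p of ξ_p such that 0 < sup{f(x) : x ∈ N_p} < ∞, and that f′(x) is bounded in N_p. Then with probability 1, F_n(ξ_p) − p = F_n(ξ_{p,n}) − F(ξ_{p,n}) + O(n^{-3/4} log n) as n → ∞. -/

import Mathlib

open MeasureTheory Filter Set

/-- The σ-algebra generated by the random variables `X i` for `i ∈ S`. -/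
noncomputable def sigmaGen {Ω : Type*} (X : ℕ → Ω → ℝ) (S : Set ℕ) : MeasurableSpace Ω :=
  ⨆ i ∈ S, MeasurableSpace.comap (X i) inferInstance

/-- The φ-mixing coefficients of the sequence `X` with respect to the measure `μ`:
`φ(n) = sup_{k ≥ 1} sup { |P(B|A) - P(B)| : A ∈ σ(X_i, 1 ≤ i ≤ k), P(A) > 0,
B ∈ σ(X_i, i ≥ k + n) }`. -/
noncomputable def phiCoef {Ω : Type*} [MeasurableSpace Ω] (X : ℕ → Ω → ℝ)
    (μ : Measure Ω) (n : ℕ) : ℝ :=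
  sSup {r : ℝ | ∃ k : ℕ, 1 ≤ k ∧ ∃ A B : Set Ω,
    MeasurableSet[sigmaGen X {i | 1 ≤ i ∧ i ≤ k}] A ∧
    MeasurableSet[sigmaGen X {i | k + n ≤ i}] B ∧
    0 < μ A ∧
    r = |(μ (A ∩ B)).toReal / (μ A).toReal - (μ B).toReal|}

/-- The empirical distribution function `F_n(x) = n⁻¹ ∑_{i=1}^n I(X_i ≤ x)`. -/
noncomputable def empDF {Ω : Type*} (X : ℕ → Ω → ℝ) (n : ℕ) (ω : Ω) (x : ℝ) : ℝ :=
  (n : ℝ)⁻¹ * ∑ i ∈ Finset.Icc 1 n, (if X i ω ≤ x then (1 : ℝ) else 0)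

/-- The `p`-th quantile `F⁻¹(p) = inf {x : F(x) ≥ p}` of a distribution function `F`. -/
noncomputable def quantile (F : ℝ → ℝ) (p : ℝ) : ℝ :=
  sInf {x : ℝ | p ≤ F x}

/-- The sample `p`-th quantile `ξ_{p,n} = F_n⁻¹(p) = inf {x : F_n(x) ≥ p}`. -/
noncomputable def sampleQuantile {Ω : Type*} (X : ℕ → Ω → ℝ) (n : ℕ) (ω : Ω) (p : ℝ) : ℝ :=
  sInf {x : ℝ | p ≤ empDF X n ω x}

lemma sigmaGen_mono {Ω : Type*} {X : ℕ → Ω → ℝ} {S T : Set ℕ} (h : S ⊆ T) : sigmaGen X S ≤ sigmaGen X T :=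
  biSup_mono h

lemma measurable_sigmaGen {Ω : Type*} {X : ℕ → Ω → ℝ} {S : Set ℕ} {i : ℕ}
    (hi : i ∈ S) :
    Measurable[sigmaGen X S] (X i) :=
  Measurable.mono (comap_measurable (X i))
    (le_iSup₂_of_le (f := fun i (_ : i ∈ S) => MeasurableSpace.comap (X i) inferInstance)
      i hi le_rfl) le_rfl

section Mixing

variable {Ω : Type*} [m0 : MeasurableSpace Ω] {μ : Measure Ω} {X : ℕ → Ω → ℝ}

lemma sigmaGen_le (hX : ∀ i, Measurable (X i)) (S : Set ℕ) : sigmaGen X S ≤ m0 :=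
  iSup₂_le fun i _ => (hX i).comap_le

lemma abs_condProb_sub_le_one [IsProbabilityMeasure μ] (A B : Set Ω) (hA : 0 < μ A) :
    |(μ (A ∩ B)).toReal / (μ A).toReal - (μ B).toReal| ≤ 1 := by
  have hA' : 0 < (μ A).toReal := ENNReal.toReal_pos hA.ne' (measure_ne_top μ A)
  have h1 : (μ (A ∩ B)).toReal / (μ A).toReal ≤ 1 := by
    rw [div_le_one hA']
    exact ENNReal.toReal_mono (measure_ne_top μ A) (measure_mono inter_subset_left)
  have h2 : 0 ≤ (μ (A ∩ B)).toReal / (μ A).toReal := by positivity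
  have h3 : (μ B).toReal ≤ 1 := measureReal_le_one
  have h4 : 0 ≤ (μ B).toReal := by positivity
  rw [abs_le]
  constructor <;> linarith

lemma bddAbove_phiCoef [IsProbabilityMeasure μ] (n : ℕ) :
    BddAbove {r : ℝ | ∃ k : ℕ, 1 ≤ k ∧ ∃ A B : Set Ω,
      MeasurableSet[sigmaGen X {i | 1 ≤ i ∧ i ≤ k}] A ∧
      MeasurableSet[sigmaGen X {i | k + n ≤ i}] B ∧
      0 < μ A ∧
      r = |(μ (A ∩ B)).toReal / (μ A).toReal - (μ B).toReal|} := by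
  refine ⟨1, ?_⟩
  rintro r ⟨k, -, A, B, -, -, hA, rfl⟩
  exact abs_condProb_sub_le_one A B hA

lemma phiCoef_nonneg (n : ℕ) : 0 ≤ phiCoef X μ n := by
  apply Real.sSup_nonneg
  rintro r ⟨k, -, A, B, -, -, hA, rfl⟩
  exact abs_nonneg _

lemma measure_inter_le_phiCoef [IsProbabilityMeasure μ] {k n : ℕ} (hk : 1 ≤ k) {A B : Set Ω}
    (hA : MeasurableSet[sigmaGen X {i | 1 ≤ i ∧ i ≤ k}] A)
    (hB : MeasurableSet[sigmaGen X {i | k + n ≤ i}] B) :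
    μ (A ∩ B) ≤ (μ B + ENNReal.ofReal (phiCoef X μ n)) * μ A := by
  rcases eq_or_ne (μ A) 0 with h0 | h0
  · rw [measure_mono_null inter_subset_left h0]
    exact zero_le
  have hA' : 0 < (μ A).toReal := ENNReal.toReal_pos h0 (measure_ne_top μ A)
  have h1 : |(μ (A ∩ B)).toReal / (μ A).toReal - (μ B).toReal| ≤ phiCoef X μ n :=
    le_csSup (bddAbove_phiCoef n) ⟨k, hk, A, B, hA, hB, pos_iff_ne_zero.2 h0, rfl⟩
  have h2 : (μ (A ∩ B)).toReal ≤ ((μ B).toReal + phiCoef X μ n) * (μ A).toReal := by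
    rw [← div_le_iff₀ hA']
    linarith [(abs_le.1 h1).2]
  rw [← ENNReal.ofReal_toReal (measure_ne_top μ (A ∩ B)),
    ← ENNReal.ofReal_toReal (measure_ne_top μ A), ← ENNReal.ofReal_toReal (measure_ne_top μ B),
    ← ENNReal.ofReal_add (by positivity) (phiCoef_nonneg n),
    ← ENNReal.ofReal_mul (add_nonneg (by positivity) (phiCoef_nonneg n))]
  exact ENNReal.ofReal_le_ofReal h2

lemma setLIntegral_le_phiCoef [IsProbabilityMeasure μ] (hX : ∀ i, Measurable (X i))
    {k n : ℕ} (hk : 1 ≤ k) {Z : Ω → ENNReal} {B : Set Ω}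
    (hZ : Measurable[sigmaGen X {i | 1 ≤ i ∧ i ≤ k}] Z)
    (hB : MeasurableSet[sigmaGen X {i | k + n ≤ i}] B) :
    ∫⁻ ω in B, Z ω ∂μ ≤ (μ B + ENNReal.ofReal (phiCoef X μ n)) * ∫⁻ ω, Z ω ∂μ := by
  have hm := sigmaGen_le hX {i | 1 ≤ i ∧ i ≤ k}
  rw [← lintegral_trim hm hZ, ← lintegral_trim hm hZ, ← smul_eq_mul, ← lintegral_smul_measure]
  apply lintegral_mono' _ le_rfl
  rw [Measure.le_iff]
  intro A hA
  rw [Measure.smul_apply, trim_measurableSet_eq hm hA, trim_measurableSet_eq hm hA,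
    Measure.restrict_apply (hm A hA)]
  exact measure_inter_le_phiCoef hk hA hB

lemma lintegral_mul_le_phiCoef [IsProbabilityMeasure μ] (hX : ∀ i, Measurable (X i))
    {k n : ℕ} (hk : 1 ≤ k) {Z : Ω → ENNReal} {W : Ω → ℝ} {M : ℝ}
    (hZ : Measurable[sigmaGen X {i | 1 ≤ i ∧ i ≤ k}] Z)
    (hW : Measurable[sigmaGen X {i | k + n ≤ i}] W)
    (hW0 : ∀ ω, 0 ≤ W ω) (hWM : ∀ ω, W ω ≤ M) :
    ∫⁻ ω, Z ω * ENNReal.ofReal (W ω) ∂μ ≤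
      (∫⁻ ω, Z ω ∂μ) * (∫⁻ ω, ENNReal.ofReal (W ω) ∂μ +
        ENNReal.ofReal M * ENNReal.ofReal (phiCoef X μ n)) := by
  have hZ' : Measurable Z := hZ.mono (sigmaGen_le hX _) le_rfl
  have hW' : Measurable W := hW.mono (sigmaGen_le hX _) le_rfl
  have hset : ∀ s : ℝ, MeasurableSet[sigmaGen X {i | k + n ≤ i}] {ω | s < W ω} :=
    fun s => hW measurableSet_Ioi
  have hanti : Antitone fun s : ℝ => μ {ω | s < W ω} :=
    fun s t hst => measure_mono fun ω (h : t < W ω) => lt_of_le_of_lt hst h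
  have hmeas : Measurable fun s : ℝ => μ {ω | s < W ω} +
      (Iio M).indicator (fun _ => ENNReal.ofReal (phiCoef X μ n)) s :=
    hanti.measurable.add (measurable_const.indicator measurableSet_Iio)
  rw [← Pi.mul_def (f := Z), ← lintegral_withDensity_eq_lintegral_mul μ hZ' hW'.ennreal_ofReal,
    lintegral_eq_lintegral_meas_lt _ (ae_of_all _ hW0) hW'.aemeasurable,
    lintegral_eq_lintegral_meas_lt μ (ae_of_all _ hW0) hW'.aemeasurable]
  calc ∫⁻ s in Ioi (0 : ℝ), μ.withDensity Z {ω | s < W ω}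
      ≤ ∫⁻ s in Ioi (0 : ℝ), (∫⁻ ω, Z ω ∂μ) * (μ {ω | s < W ω} +
          (Iio M).indicator (fun _ => ENNReal.ofReal (phiCoef X μ n)) s) := by
        refine lintegral_mono fun s => ?_
        rw [withDensity_apply _ (sigmaGen_le hX _ _ (hset s))]
        by_cases hs : s < M
        · rw [indicator_of_mem (show s ∈ Iio M from hs), mul_comm]
          exact setLIntegral_le_phiCoef hX hk hZ (hset s)
        · have : {ω | s < W ω} = ∅ := by
            ext ω
            simpa using (hWM ω).trans (not_lt.1 hs)
          simp [this]
    _ = _ := by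
        rw [lintegral_const_mul _ hmeas,
          lintegral_add_left hanti.measurable, lintegral_indicator measurableSet_Iio,
          setLIntegral_const, Measure.restrict_apply measurableSet_Iio, Iio_inter_Ioi,
          Real.volume_Ioo, sub_zero, mul_comm (ENNReal.ofReal M)]

lemma integrable_of_abs_le [IsFiniteMeasure μ] {f : Ω → ℝ} {C : ℝ} (hf : Measurable f)
    (h : ∀ ω, |f ω| ≤ C) : Integrable f μ :=
  Integrable.of_bound hf.aestronglyMeasurable C (ae_of_all _ h)

lemma integral_mul_le_phiCoef [IsProbabilityMeasure μ] (hX : ∀ i, Measurable (X i))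
    {k n : ℕ} (hk : 1 ≤ k) {Z W : Ω → ℝ} {C M : ℝ}
    (hZ : Measurable[sigmaGen X {i | 1 ≤ i ∧ i ≤ k}] Z)
    (hW : Measurable[sigmaGen X {i | k + n ≤ i}] W)
    (hZ0 : ∀ ω, 0 ≤ Z ω) (hZC : ∀ ω, Z ω ≤ C)
    (hW0 : ∀ ω, 0 ≤ W ω) (hWM : ∀ ω, W ω ≤ M) :
    ∫ ω, Z ω * W ω ∂μ ≤ (∫ ω, Z ω ∂μ) * (∫ ω, W ω ∂μ + M * phiCoef X μ n) := by
  have hZ' : Measurable Z := hZ.mono (sigmaGen_le hX _) le_rfl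
  have hW' : Measurable W := hW.mono (sigmaGen_le hX _) le_rfl
  obtain ⟨ω₀⟩ := nonempty_of_isProbabilityMeasure μ
  have hM : 0 ≤ M := (hW0 ω₀).trans (hWM ω₀)
  have hZi : Integrable Z μ :=
    integrable_of_abs_le hZ' fun ω => by rw [abs_of_nonneg (hZ0 ω)]; exact hZC ω
  have hWi : Integrable W μ :=
    integrable_of_abs_le hW' fun ω => by rw [abs_of_nonneg (hW0 ω)]; exact hWM ω
  have hZWi : Integrable (fun ω => Z ω * W ω) μ :=
    integrable_of_abs_le (C := C * M) (hZ'.mul hW') fun ω => by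
      rw [abs_of_nonneg (mul_nonneg (hZ0 ω) (hW0 ω))]
      exact mul_le_mul (hZC ω) (hWM ω) (hW0 ω) ((hZ0 ω).trans (hZC ω))
  have hEW : 0 ≤ ∫ ω, W ω ∂μ := integral_nonneg hW0
  have hEZ : 0 ≤ ∫ ω, Z ω ∂μ := integral_nonneg hZ0
  have hφ := phiCoef_nonneg (X := X) (μ := μ) n
  have h := lintegral_mul_le_phiCoef (μ := μ) hX hk hZ.ennreal_ofReal hW hW0 hWM
  simp_rw [← fun ω => ENNReal.ofReal_mul (q := W ω) (hZ0 ω)] at h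
  rwa [← ofReal_integral_eq_lintegral_ofReal hZi (ae_of_all _ hZ0),
    ← ofReal_integral_eq_lintegral_ofReal hWi (ae_of_all _ hW0),
    ← ofReal_integral_eq_lintegral_ofReal hZWi
      (ae_of_all _ fun ω => mul_nonneg (hZ0 ω) (hW0 ω)),
    ← ENNReal.ofReal_mul hM, ← ENNReal.ofReal_add hEW (mul_nonneg hM hφ),
    ← ENNReal.ofReal_mul hEZ,
    ENNReal.ofReal_le_ofReal_iff (mul_nonneg hEZ (add_nonneg hEW (mul_nonneg hM hφ)))] at h

end Mixing

/-- `Y` is a sequence of centered variables bounded by one, with first absolute moments at most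
`δ`, where `Y i` is a function of `X i`. -/
structure IsCenteredBounded {Ω : Type*} [MeasurableSpace Ω] (X : ℕ → Ω → ℝ) (μ : Measure Ω)
    (δ : ℝ) (Y : ℕ → Ω → ℝ) : Prop where
  measurable_sigmaGen : ∀ i, Measurable[sigmaGen X {i}] (Y i)
  abs_le_one : ∀ i ω, |Y i ω| ≤ 1
  integral_eq_zero : ∀ i, ∫ ω, Y i ω ∂μ = 0
  integral_abs_le : ∀ i, ∫ ω, |Y i ω| ∂μ ≤ δ

section Moments

variable {Ω : Type*} [m0 : MeasurableSpace Ω] {μ : Measure Ω} {X : ℕ → Ω → ℝ}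

lemma integral_mul_le_of_integral_eq_zero [IsProbabilityMeasure μ] (hX : ∀ i, Measurable (X i))
    {k n : ℕ} (hk : 1 ≤ k) {Y Y' : Ω → ℝ}
    (hY : Measurable[sigmaGen X {i | 1 ≤ i ∧ i ≤ k}] Y)
    (hY' : Measurable[sigmaGen X {i | k + n ≤ i}] Y')
    (hY1 : ∀ ω, |Y ω| ≤ 1) (hY'1 : ∀ ω, |Y' ω| ≤ 1) (h0 : ∫ ω, Y' ω ∂μ = 0) :
    ∫ ω, Y ω * Y' ω ∂μ ≤ 2 * phiCoef X μ n * ∫ ω, |Y ω| ∂μ := by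
  have hYm : Measurable Y := hY.mono (sigmaGen_le hX _) le_rfl
  have hY'm : Measurable Y' := hY'.mono (sigmaGen_le hX _) le_rfl
  have hYi : Integrable Y μ := integrable_of_abs_le hYm hY1
  have hY'i : Integrable Y' μ := integrable_of_abs_le hY'm hY'1
  have key : ∀ {Z V : Ω → ℝ}, Measurable[sigmaGen X {i | 1 ≤ i ∧ i ≤ k}] Z →
      Measurable[sigmaGen X {i | k + n ≤ i}] V → (∀ ω, |Z ω| ≤ 1) → (∀ ω, |V ω| ≤ 1) →
      ∫ ω, V ω ∂μ = 0 →
      ∫ ω, max (Z ω) 0 * V ω ∂μ ≤ (∫ ω, max (Z ω) 0 ∂μ) * (2 * phiCoef X μ n) := by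
    intro Z V hZ hV hZ1 hV1 hV0
    have hZm : Measurable Z := hZ.mono (sigmaGen_le hX _) le_rfl
    have hVm : Measurable V := hV.mono (sigmaGen_le hX _) le_rfl
    have hVi : Integrable V μ := integrable_of_abs_le hVm hV1
    have hZp : ∀ ω, |max (Z ω) 0| ≤ 1 := fun ω => by
      rw [abs_of_nonneg (le_max_right _ _)]
      exact max_le ((le_abs_self _).trans (hZ1 ω)) zero_le_one
    have hZi : Integrable (fun ω => max (Z ω) 0) μ :=
      integrable_of_abs_le (hZm.max measurable_const) hZp
    have hZVi : Integrable (fun ω => max (Z ω) 0 * V ω) μ :=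
      integrable_of_abs_le (C := 1) ((hZm.max measurable_const).mul hVm) fun ω => by
        rw [abs_mul]
        exact mul_le_one₀ (hZp ω) (abs_nonneg _) (hV1 ω)
    have h := integral_mul_le_phiCoef (μ := μ) hX hk (Z := fun ω => max (Z ω) 0)
      (W := fun ω => V ω + 1) (C := 1) (M := 2) (hZ.max measurable_const)
      (hV.add measurable_const) (fun ω => le_max_right _ _)
      (fun ω => (le_abs_self _).trans (hZp ω))
      (fun ω => by linarith [(abs_le.1 (hV1 ω)).1]) (fun ω => by linarith [(abs_le.1 (hV1 ω)).2])
    simp only [mul_add, mul_one] at h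
    rw [integral_add hZVi hZi, integral_add hVi (integrable_const _), hV0] at h
    simp only [integral_const, probReal_univ, smul_eq_mul, mul_one] at h
    linarith
  have h1 := key hY hY' hY1 hY'1 h0
  have h2 := key hY.neg hY'.neg (fun ω => by simpa using hY1 ω) (fun ω => by simpa using hY'1 ω)
    (by simp [integral_neg, h0])
  simp only [Pi.neg_apply] at h2
  have i1 : Integrable (fun ω => max (Y ω) 0) μ := hYi.pos_part
  have i2 : Integrable (fun ω => max (-Y ω) 0) μ := hYi.neg_part
  have i3 : Integrable (fun ω => max (Y ω) 0 * Y' ω) μ :=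
    i1.mul_bdd (c := 1) hY'm.aestronglyMeasurable (ae_of_all _ hY'1)
  have i4 : Integrable (fun ω => max (-Y ω) 0 * -Y' ω) μ :=
    i2.mul_bdd (c := 1) hY'm.neg.aestronglyMeasurable (ae_of_all _ fun ω => by simpa using hY'1 ω)
  have e1 : ∫ ω, Y ω * Y' ω ∂μ
      = ∫ ω, max (Y ω) 0 * Y' ω ∂μ + ∫ ω, max (-Y ω) 0 * -Y' ω ∂μ := by
    rw [← integral_add i3 i4]
    refine integral_congr_ae (ae_of_all _ fun ω => ?_)
    rcases le_total 0 (Y ω) with h | h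
    · simp [h]
    · simp [h]
  have e2 : ∫ ω, |Y ω| ∂μ = ∫ ω, max (Y ω) 0 ∂μ + ∫ ω, max (-Y ω) 0 ∂μ := by
    rw [← integral_add i1 i2]
    refine integral_congr_ae (ae_of_all _ fun ω => ?_)
    rcases le_total 0 (Y ω) with h | h
    · simp [h, abs_of_nonneg]
    · simp [h, abs_of_nonpos]
  rw [e1, e2]
  linarith

namespace IsCenteredBounded

variable {δ : ℝ} {Y : ℕ → Ω → ℝ}

lemma measurable (h : IsCenteredBounded X μ δ Y) (hX : ∀ i, Measurable (X i)) (i : ℕ) :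
    Measurable (Y i) :=
  (h.measurable_sigmaGen i).mono (sigmaGen_le hX _) le_rfl

lemma measurable_of_mem (h : IsCenteredBounded X μ δ Y) {S : Set ℕ} {i : ℕ} (hi : i ∈ S) :
    Measurable[sigmaGen X S] (Y i) :=
  (h.measurable_sigmaGen i).mono (sigmaGen_mono (singleton_subset_iff.2 hi)) le_rfl

lemma abs_sum_le (h : IsCenteredBounded X μ δ Y) (a q : ℕ) (ω : Ω) :
    |∑ i ∈ Finset.range q, Y (a + i) ω| ≤ q := by
  refine (Finset.abs_sum_le_sum_abs _ _).trans ?_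
  refine (Finset.sum_le_sum fun i _ => h.abs_le_one (a + i) ω).trans ?_
  simp

lemma integral_sum_eq_zero [IsProbabilityMeasure μ] (h : IsCenteredBounded X μ δ Y)
    (hX : ∀ i, Measurable (X i)) (a q : ℕ) :
    ∫ ω, ∑ i ∈ Finset.range q, Y (a + i) ω ∂μ = 0 := by
  rw [integral_finsetSum _ fun i _ => integrable_of_abs_le (h.measurable hX _) (h.abs_le_one _)]
  exact Finset.sum_eq_zero fun i _ => h.integral_eq_zero _

lemma integral_sum_sq_le [IsProbabilityMeasure μ] (h : IsCenteredBounded X μ δ Y)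
    (hX : ∀ i, Measurable (X i)) {Φ : ℝ}
    (hΦ : ∀ q, ∑ i ∈ Finset.range q, phiCoef X μ (i + 1) ≤ Φ) (a q : ℕ) :
    ∫ ω, (∑ i ∈ Finset.range q, Y (a + 1 + i) ω) ^ 2 ∂μ ≤ q * (δ * (1 + 4 * Φ)) := by
  have hδ : 0 ≤ δ := (integral_nonneg fun ω => abs_nonneg _).trans (h.integral_abs_le 0)
  induction q with
  | zero => simp
  | succ q ih =>
    set S : Ω → ℝ := fun ω => ∑ i ∈ Finset.range q, Y (a + 1 + i) ω with hS
    have hSm : Measurable S := Finset.measurable_fun_sum _ fun i _ => h.measurable hX _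
    have hYm := h.measurable hX (a + 1 + q)
    have hYY : ∀ i j, Integrable (fun ω => Y i ω * Y j ω) μ := fun i j =>
      integrable_of_abs_le (C := 1) ((h.measurable hX i).mul (h.measurable hX j)) fun ω => by
        rw [abs_mul]
        exact mul_le_one₀ (h.abs_le_one _ _) (abs_nonneg _) (h.abs_le_one _ _)
    have iS : Integrable (fun ω => S ω ^ 2) μ :=
      integrable_of_abs_le (C := (q : ℝ) ^ 2) (hSm.pow_const 2) fun ω => by
        rw [abs_pow]
        exact pow_le_pow_left₀ (abs_nonneg _) (h.abs_sum_le _ _ _) 2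
    have iSY : Integrable (fun ω => ∑ i ∈ Finset.range q, Y (a + 1 + i) ω * Y (a + 1 + q) ω) μ :=
      integrable_finsetSum _ fun i _ => hYY _ _
    have e : ∀ ω, (∑ i ∈ Finset.range (q + 1), Y (a + 1 + i) ω) ^ 2 =
        S ω ^ 2 + 2 * ∑ i ∈ Finset.range q, Y (a + 1 + i) ω * Y (a + 1 + q) ω
          + Y (a + 1 + q) ω * Y (a + 1 + q) ω := fun ω => by
      rw [Finset.sum_range_succ, ← Finset.sum_mul]
      ring
    simp_rw [e]
    have iT : Integrable (fun ω => S ω ^ 2 +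
        2 * ∑ i ∈ Finset.range q, Y (a + 1 + i) ω * Y (a + 1 + q) ω) μ := iS.add (iSY.const_mul 2)
    rw [integral_add iT (hYY _ _), integral_add iS (iSY.const_mul 2),
      integral_const_mul, integral_finsetSum _ fun i _ => hYY _ _]
    have hcov : ∑ i ∈ Finset.range q, ∫ ω, Y (a + 1 + i) ω * Y (a + 1 + q) ω ∂μ ≤ 2 * δ * Φ := by
      calc _ ≤ ∑ i ∈ Finset.range q, 2 * δ * phiCoef X μ (q - 1 - i + 1) := by
            refine Finset.sum_le_sum fun i hi => ?_
            have hi' := Finset.mem_range.1 hi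
            refine (integral_mul_le_of_integral_eq_zero (k := a + 1 + i) (n := q - 1 - i + 1) hX
              (by omega) (h.measurable_of_mem ⟨by omega, by omega⟩)
              (h.measurable_of_mem (by simp only [mem_ofPred_eq]; omega))
              (h.abs_le_one _) (h.abs_le_one _) (h.integral_eq_zero _)).trans ?_
            nlinarith [h.integral_abs_le (a + 1 + i),
              phiCoef_nonneg (X := X) (μ := μ) (q - 1 - i + 1)]
        _ = 2 * δ * ∑ i ∈ Finset.range q, phiCoef X μ (i + 1) := by
            rw [← Finset.mul_sum, Finset.sum_range_reflect fun i => phiCoef X μ (i + 1)]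
        _ ≤ 2 * δ * Φ := by
            exact mul_le_mul_of_nonneg_left (hΦ q) (by positivity)
    have hsq : ∫ ω, Y (a + 1 + q) ω * Y (a + 1 + q) ω ∂μ ≤ δ := by
      refine le_trans (integral_mono (hYY _ _)
        (integrable_of_abs_le hYm (h.abs_le_one _)).abs fun ω => ?_) (h.integral_abs_le (a + 1 + q))
      have := h.abs_le_one (a + 1 + q) ω
      calc Y (a + 1 + q) ω * Y (a + 1 + q) ω = |Y (a + 1 + q) ω| * |Y (a + 1 + q) ω| :=
            (abs_mul_abs_self _).symm
        _ ≤ |Y (a + 1 + q) ω| := mul_le_of_le_one_left (abs_nonneg _) this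
    push_cast
    linarith

lemma integral_exp_sum_le [IsProbabilityMeasure μ] (h : IsCenteredBounded X μ δ Y)
    (hX : ∀ i, Measurable (X i)) {Φ : ℝ}
    (hΦ : ∀ q, ∑ i ∈ Finset.range q, phiCoef X μ (i + 1) ≤ Φ) (a q : ℕ) {c : ℝ}
    (hc0 : 0 ≤ c) (hc : c * q ≤ 1) :
    ∫ ω, Real.exp (c * ∑ i ∈ Finset.range q, Y (a + 1 + i) ω) ∂μ ≤
      1 + c ^ 2 * (q * (δ * (1 + 4 * Φ))) := by
  set S : Ω → ℝ := fun ω => ∑ i ∈ Finset.range q, Y (a + 1 + i) ω with hS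
  have hSm : Measurable S := Finset.measurable_fun_sum _ fun i _ => h.measurable hX _
  have hSq : ∀ ω, |S ω| ≤ q := h.abs_sum_le _ _
  have hcS : ∀ ω, |c * S ω| ≤ 1 := fun ω => by
    rw [abs_mul, abs_of_nonneg hc0]
    exact (mul_le_mul_of_nonneg_left (hSq ω) hc0).trans hc
  have iS : Integrable S μ := integrable_of_abs_le hSm hSq
  have iS2 : Integrable (fun ω => S ω ^ 2) μ :=
    integrable_of_abs_le (C := (q : ℝ) ^ 2) (hSm.pow_const 2) fun ω => by
      rw [abs_pow]
      exact pow_le_pow_left₀ (abs_nonneg _) (hSq ω) 2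
  have iE : Integrable (fun ω => Real.exp (c * S ω)) μ :=
    integrable_of_abs_le (C := Real.exp 1) (hSm.const_mul c).exp fun ω => by
      rw [Real.abs_exp]
      exact Real.exp_le_exp.2 ((le_abs_self _).trans (hcS ω))
  have iL : Integrable (fun ω => 1 + c * S ω) μ := (integrable_const _).add (iS.const_mul c)
  calc ∫ ω, Real.exp (c * S ω) ∂μ ≤ ∫ ω, (1 + c * S ω) + c ^ 2 * S ω ^ 2 ∂μ := by
        refine integral_mono iE (iL.add (iS2.const_mul _)) fun ω => ?_
        have := (abs_le.1 (Real.abs_exp_sub_one_sub_id_le (hcS ω))).2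
        simp only
        nlinarith
    _ = 1 + c ^ 2 * ∫ ω, S ω ^ 2 ∂μ := by
        rw [integral_add iL (iS2.const_mul _), integral_add (integrable_const _) (iS.const_mul c),
          integral_const_mul, integral_const_mul, h.integral_sum_eq_zero hX]
        simp
    _ ≤ _ := by
        gcongr
        exact h.integral_sum_sq_le hX hΦ a q

/-- Exponential moments of a sum over every second block of length `q`. -/
lemma integral_exp_alternating_blocks_le [IsProbabilityMeasure μ] (h : IsCenteredBounded X μ δ Y)
    (hX : ∀ i, Measurable (X i)) {Φ : ℝ}
    (hΦ : ∀ q, ∑ i ∈ Finset.range q, phiCoef X μ (i + 1) ≤ Φ) (s : ℕ) {q : ℕ} (hq : 1 ≤ q) {c : ℝ}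
    (hc0 : 0 ≤ c) (hc : c * q ≤ 1) (J : ℕ) :
    ∫ ω, Real.exp (c * ∑ l ∈ Finset.range J, ∑ i ∈ Finset.range q,
        Y (s + l * (2 * q) + 1 + i) ω) ∂μ ≤
      (1 + c ^ 2 * (q * (δ * (1 + 4 * Φ))) + 3 * phiCoef X μ q) ^ J := by
  have hφ := phiCoef_nonneg (X := X) (μ := μ) q
  set v := 1 + c ^ 2 * (q * (δ * (1 + 4 * Φ))) with hv
  have hW := fun l => h.integral_exp_sum_le hX hΦ (s + l * (2 * q)) q hc0 hc
  set S : ℕ → Ω → ℝ := fun l ω => ∑ i ∈ Finset.range q, Y (s + l * (2 * q) + 1 + i) ω with hS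
  have hv0 : 0 ≤ v := (integral_nonneg fun ω => (Real.exp_pos _).le).trans (hW 0)
  have hSm : ∀ {T : Set ℕ} (l : ℕ), (∀ i < q, s + l * (2 * q) + 1 + i ∈ T) →
      Measurable[sigmaGen X T] (S l) := fun l hl =>
    Finset.measurable_fun_sum _ fun i hi => h.measurable_of_mem (hl i (Finset.mem_range.1 hi))
  have hSq : ∀ l ω, c * S l ω ≤ 1 := fun l ω =>
    (mul_le_mul_of_nonneg_left ((le_abs_self _).trans (h.abs_sum_le _ _ _)) hc0).trans hc
  induction J with
  | zero => simp
  | succ J ih =>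
    simp_rw [Finset.sum_range_succ, mul_add, Real.exp_add]
    rcases Nat.eq_zero_or_pos J with rfl | hJ
    · simp only [Finset.range_zero, Finset.sum_empty, mul_zero, Real.exp_zero, one_mul, zero_add,
        pow_one]
      linarith [hW 0]
    have hlt : ∀ l < J, l * (2 * q) + 2 * q ≤ J * (2 * q) := fun l hl => by
      calc l * (2 * q) + 2 * q = (l + 1) * (2 * q) := by ring
        _ ≤ J * (2 * q) := Nat.mul_le_mul_right _ hl
    have hJ0 := hlt 0 hJ
    have hmul := integral_mul_le_phiCoef (μ := μ) (X := X) hX (k := s + J * (2 * q) - q) (n := q)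
      (by omega)
      (Z := fun ω => Real.exp (c * ∑ l ∈ Finset.range J, S l ω))
      (W := fun ω => Real.exp (c * S J ω)) (C := Real.exp J) (M := 3)
      ((Finset.measurable_fun_sum _ fun l hl => hSm l fun i hi => by
        have := hlt l (Finset.mem_range.1 hl)
        constructor <;> omega).const_mul c).exp
      ((hSm J fun i hi => by simp only [mem_ofPred_eq]; omega).const_mul c).exp
      (fun ω => (Real.exp_pos _).le)
      (fun ω => Real.exp_le_exp.2 (by
        rw [Finset.mul_sum]
        exact (Finset.sum_le_sum fun l _ => hSq l ω).trans (by simp)))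
      (fun ω => (Real.exp_pos _).le)
      (fun ω => (Real.exp_le_exp.2 (hSq J ω)).trans (by linarith [Real.exp_one_lt_d9]))
    refine hmul.trans ?_
    rw [pow_succ]
    refine mul_le_mul ih (by linarith [hW J]) ?_ (by positivity)
    exact add_nonneg (integral_nonneg fun ω => (Real.exp_pos _).le) (by positivity)

lemma integral_exp_le_pow [IsProbabilityMeasure μ] (h : IsCenteredBounded X μ δ Y)
    (hX : ∀ i, Measurable (X i)) {Φ : ℝ}
    (hΦ : ∀ q, ∑ i ∈ Finset.range q, phiCoef X μ (i + 1) ≤ Φ) {q : ℕ} (hq : 1 ≤ q) {c : ℝ}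
    (hc0 : 0 ≤ c) (hc : 2 * c * q ≤ 1) (J : ℕ) :
    ∫ ω, Real.exp (c * ∑ i ∈ Finset.range (J * (2 * q)), Y (i + 1) ω) ∂μ ≤
      (1 + (2 * c) ^ 2 * (q * (δ * (1 + 4 * Φ))) + 3 * phiCoef X μ q) ^ J := by
  have hA := h.integral_exp_alternating_blocks_le hX hΦ 0 hq (by positivity) hc J
  have hB := h.integral_exp_alternating_blocks_le hX hΦ q hq (by positivity) hc J
  set A : Ω → ℝ := fun ω => ∑ l ∈ Finset.range J, ∑ i ∈ Finset.range q,
    Y (0 + l * (2 * q) + 1 + i) ω with hAdef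
  set B : Ω → ℝ := fun ω => ∑ l ∈ Finset.range J, ∑ i ∈ Finset.range q,
    Y (q + l * (2 * q) + 1 + i) ω with hBdef
  have hsum : ∀ ω, ∑ i ∈ Finset.range (J * (2 * q)), Y (i + 1) ω = A ω + B ω := by
    intro ω
    simp only [hAdef, hBdef]
    clear hA hB hAdef hBdef A B
    induction J with
    | zero => simp
    | succ J ih =>
      rw [Finset.sum_range_succ, Finset.sum_range_succ, add_mul, one_mul, Finset.sum_range_add, ih,
        two_mul q, Finset.sum_range_add, ← two_mul q]
      have e1 : ∀ i, J * (2 * q) + i + 1 = 0 + J * (2 * q) + 1 + i := fun i => by ring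
      have e2 : ∀ i, 0 + J * (2 * q) + 1 + (q + i) = q + J * (2 * q) + 1 + i := fun i => by ring
      simp_rw [e1, e2]
      ring
  have hbd : ∀ {D : Ω → ℝ}, Measurable D → (∀ ω, |D ω| ≤ J * q) →
      Integrable (fun ω => Real.exp (2 * c * D ω)) μ := fun {D} hD hDb =>
    integrable_of_abs_le (C := Real.exp (2 * c * (J * q))) (hD.const_mul _).exp fun ω => by
      rw [Real.abs_exp]
      exact Real.exp_le_exp.2
        (mul_le_mul_of_nonneg_left ((le_abs_self _).trans (hDb ω)) (by positivity))
  have hblock : ∀ s ω, |∑ l ∈ Finset.range J, ∑ i ∈ Finset.range q,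
      Y (s + l * (2 * q) + 1 + i) ω| ≤ J * q := fun s ω => by
    refine (Finset.abs_sum_le_sum_abs _ _).trans ?_
    refine (Finset.sum_le_sum fun l _ => h.abs_sum_le _ _ ω).trans ?_
    simp
  have hAm : Measurable A := Finset.measurable_fun_sum _ fun l _ =>
    Finset.measurable_fun_sum _ fun i _ => h.measurable hX _
  have hBm : Measurable B := Finset.measurable_fun_sum _ fun l _ =>
    Finset.measurable_fun_sum _ fun i _ => h.measurable hX _
  have iA := hbd hAm (hblock 0)
  have iB := hbd hBm (hblock q)
  have hpt : ∀ ω, Real.exp (c * (A ω + B ω)) ≤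
      2⁻¹ * (Real.exp (2 * c * A ω) + Real.exp (2 * c * B ω)) := fun ω => by
    have e1 : Real.exp (2 * c * A ω) = Real.exp (c * A ω) ^ 2 := by
      rw [← Real.exp_nat_mul]; push_cast; ring_nf
    have e2 : Real.exp (2 * c * B ω) = Real.exp (c * B ω) ^ 2 := by
      rw [← Real.exp_nat_mul]; push_cast; ring_nf
    rw [mul_add, Real.exp_add, e1, e2]
    nlinarith [sq_nonneg (Real.exp (c * A ω) - Real.exp (c * B ω))]
  simp_rw [hsum]
  calc ∫ ω, Real.exp (c * (A ω + B ω)) ∂μ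
      ≤ ∫ ω, 2⁻¹ * (Real.exp (2 * c * A ω) + Real.exp (2 * c * B ω)) ∂μ := by
        refine integral_mono_of_nonneg (ae_of_all _ fun ω => (Real.exp_pos _).le)
          ((iA.add iB).const_mul _) (ae_of_all _ hpt)
    _ ≤ _ := by
        rw [integral_const_mul, integral_add iA iB]
        linarith

end IsCenteredBounded

end Moments

section Tail

variable {Ω : Type*} [m0 : MeasurableSpace Ω] {μ : Measure Ω} {X : ℕ → Ω → ℝ}

lemma exists_phiCoef_le
    (hphi : (fun n : ℕ => phiCoef X μ n) =O[atTop] fun n : ℕ => ((n : ℝ) ^ 3)⁻¹) :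
    ∃ K : ℝ, 0 < K ∧ ∀ n : ℕ, 1 ≤ n → phiCoef X μ n ≤ K * ((n : ℝ) ^ 3)⁻¹ := by
  obtain ⟨K, hK, h⟩ := Asymptotics.bound_of_isBigO_nat_atTop hphi
  refine ⟨K, hK, fun n hn => ?_⟩
  have hn0 : (0 : ℝ) < n := by exact_mod_cast hn
  have h1 := h (x := n) (by positivity)
  rw [Real.norm_of_nonneg (phiCoef_nonneg n), Real.norm_of_nonneg (by positivity)] at h1
  exact h1

lemma exists_sum_phiCoef_le
    (hphi : (fun n : ℕ => phiCoef X μ n) =O[atTop] fun n : ℕ => ((n : ℝ) ^ 3)⁻¹) :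
    ∃ Φ : ℝ, 0 ≤ Φ ∧ ∀ q, ∑ i ∈ Finset.range q, phiCoef X μ (i + 1) ≤ Φ := by
  obtain ⟨K, hK, h⟩ := exists_phiCoef_le hphi
  have hs : Summable fun i : ℕ => K * (((i + 1 : ℕ) : ℝ) ^ 3)⁻¹ :=
    ((summable_nat_add_iff 1).2 (Real.summable_nat_pow_inv.2 (by norm_num : 1 < 3))).mul_left K
  refine ⟨∑' i : ℕ, K * (((i + 1 : ℕ) : ℝ) ^ 3)⁻¹, tsum_nonneg fun i => by positivity,
    fun q => ?_⟩
  exact (Finset.sum_le_sum fun i _ => h (i + 1) (by omega)).trans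
    (hs.sum_le_tsum _ fun i _ => by positivity)

lemma exists_integral_exp_le [IsProbabilityMeasure μ] (hX : ∀ i, Measurable (X i))
    (hphi : (fun n : ℕ => phiCoef X μ n) =O[atTop] fun n : ℕ => ((n : ℝ) ^ 3)⁻¹) :
    ∃ C : ℝ, 0 < C ∧ ∀ (n : ℕ), 16 ≤ n → ∀ (δ : ℝ) (Y : ℕ → Ω → ℝ), IsCenteredBounded X μ δ Y →
      (∀ i, n < i → Y i = 0) → ∀ c : ℝ, 0 ≤ c → 4 * c * (n : ℝ) ^ (1 / 4 : ℝ) ≤ 1 →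
      ∫ ω, Real.exp (c * ∑ i ∈ Finset.range n, Y (i + 1) ω) ∂μ ≤
        C * Real.exp (C * c ^ 2 * δ * n) := by
  obtain ⟨K, hK, hφ⟩ := exists_phiCoef_le hphi
  obtain ⟨Φ, hΦ0, hΦ⟩ := exists_sum_phiCoef_le hphi
  refine ⟨4 * (1 + 4 * Φ) + Real.exp (3 * K), by positivity, fun n hn δ Y hY hY0 c hc0 hc => ?_⟩
  have hδ : 0 ≤ δ := (integral_nonneg fun ω => abs_nonneg _).trans (hY.integral_abs_le 0)
  set u : ℝ := (n : ℝ) ^ (1 / 4 : ℝ) with hu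
  have hu4 : u ^ 4 = n := by
    rw [hu, ← Real.rpow_natCast, ← Real.rpow_mul (by positivity)]
    norm_num
  have hu0 : 0 ≤ u := by positivity
  have hu2 : 2 ≤ u := by
    have : (16 : ℝ) ≤ n := by exact_mod_cast hn
    by_contra! hlt
    have : u ^ 4 < 2 ^ 4 := pow_lt_pow_left₀ hlt hu0 (by norm_num)
    linarith
  set q : ℕ := ⌈u⌉₊ with hq
  have huq : u ≤ q := Nat.le_ceil u
  have hqu : (q : ℝ) ≤ 2 * u := by linarith [Nat.ceil_lt_add_one hu0]
  have hq1 : 1 ≤ q := by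
    have : (1 : ℝ) ≤ q := by linarith
    exact_mod_cast this
  set J : ℕ := n / (2 * q) + 1 with hJ
  have hJn : n ≤ J * (2 * q) := by
    have := Nat.lt_div_mul_add (a := n) (b := 2 * q) (by omega)
    rw [hJ, add_mul, one_mul]
    omega
  have hJq : (J : ℝ) * q ≤ n := by
    have h1 : ((n / (2 * q) * (2 * q) : ℕ) : ℝ) ≤ n := by exact_mod_cast Nat.div_mul_le_self _ _
    push_cast at h1
    have h2 : 8 * u ≤ n := by
      rw [← hu4]
      nlinarith [pow_le_pow_left₀ (by norm_num) hu2 3]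
    rw [hJ]
    push_cast
    nlinarith
  have hJu : (J : ℝ) ≤ u ^ 3 := by
    have : (J : ℝ) * u ≤ u ^ 3 * u := by
      calc (J : ℝ) * u ≤ J * q := by gcongr
        _ ≤ n := hJq
        _ = u ^ 3 * u := by rw [← hu4]; ring
    exact le_of_mul_le_mul_right this (by linarith)
  have hJφ : J * phiCoef X μ q ≤ K := by
    calc J * phiCoef X μ q ≤ u ^ 3 * (K * ((q : ℝ) ^ 3)⁻¹) :=
          mul_le_mul hJu (hφ q hq1) (phiCoef_nonneg q) (by positivity)
      _ ≤ u ^ 3 * (K * (u ^ 3)⁻¹) := by gcongr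
      _ = K := by
          have : u ≠ 0 := by linarith
          field_simp
  have hsum : ∀ ω, ∑ i ∈ Finset.range n, Y (i + 1) ω
      = ∑ i ∈ Finset.range (J * (2 * q)), Y (i + 1) ω := fun ω => by
    refine Finset.sum_subset (Finset.range_mono hJn) fun i _ hi => ?_
    rw [Finset.mem_range, not_lt] at hi
    rw [hY0 (i + 1) (by omega), Pi.zero_apply]
  simp_rw [hsum]
  refine (hY.integral_exp_le_pow hX hΦ hq1 hc0 ?_ J).trans ?_
  · nlinarith
  set D := 1 + 4 * Φ with hD
  have hD0 : 0 ≤ D := by positivity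
  have hφ0 := phiCoef_nonneg (X := X) (μ := μ) q
  have hle : 1 + (2 * c) ^ 2 * (q * (δ * D)) + 3 * phiCoef X μ q ≤
      Real.exp ((2 * c) ^ 2 * (q * (δ * D)) + 3 * phiCoef X μ q) := by
    linarith [Real.add_one_le_exp ((2 * c) ^ 2 * (q * (δ * D)) + 3 * phiCoef X μ q)]
  calc _ ≤ Real.exp ((2 * c) ^ 2 * (q * (δ * D)) + 3 * phiCoef X μ q) ^ J :=
        pow_le_pow_left₀ (by positivity) hle J
    _ = Real.exp ((J * q) * (4 * D * c ^ 2 * δ) + 3 * (J * phiCoef X μ q)) := by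
        rw [← Real.exp_nat_mul]
        ring_nf
    _ ≤ Real.exp (n * (4 * D * c ^ 2 * δ) + 3 * K) := by gcongr
    _ = Real.exp (3 * K) * Real.exp (4 * D * c ^ 2 * δ * n) := by
        rw [← Real.exp_add]
        ring_nf
    _ ≤ (4 * D + Real.exp (3 * K)) * Real.exp ((4 * D + Real.exp (3 * K)) * c ^ 2 * δ * n) := by
        gcongr
        · linarith
        · linarith [Real.exp_pos (3 * K)]

lemma exists_tail_le [IsProbabilityMeasure μ] (hX : ∀ i, Measurable (X i))
    (hphi : (fun n : ℕ => phiCoef X μ n) =O[atTop] fun n : ℕ => ((n : ℝ) ^ 3)⁻¹) :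
    ∃ C : ℝ, 0 < C ∧ ∀ (n : ℕ), 16 ≤ n → ∀ (δ : ℝ) (g : ℝ → ℝ), Measurable g → (∀ x, |g x| ≤ 1) →
      (∀ i, 1 ≤ i → ∫ ω, g (X i ω) ∂μ = 0) → (∀ i, 1 ≤ i → ∫ ω, |g (X i ω)| ∂μ ≤ δ) →
      ∀ c t : ℝ, 0 ≤ c → 4 * c * (n : ℝ) ^ (1 / 4 : ℝ) ≤ 1 →
      μ.real {ω | t ≤ ∑ i ∈ Finset.Icc 1 n, g (X i ω)} ≤
        C * Real.exp (C * c ^ 2 * δ * n - c * t) := by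
  obtain ⟨C, hC, h⟩ := exists_integral_exp_le hX hphi
  refine ⟨C, hC, fun n hn δ g hg hg1 hg0 hgδ c t hc0 hc => ?_⟩
  classical
  have hδ : 0 ≤ δ := (integral_nonneg fun ω => abs_nonneg _).trans (hgδ 1 le_rfl)
  set Y : ℕ → Ω → ℝ := fun i ω => if 1 ≤ i ∧ i ≤ n then g (X i ω) else 0 with hYdef
  have hY : IsCenteredBounded X μ δ Y := by
    constructor
    · intro i
      by_cases hi : 1 ≤ i ∧ i ≤ n
      · simp only [hYdef, if_pos hi]
        exact hg.comp (measurable_sigmaGen (mem_singleton i))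
      · simp only [hYdef, if_neg hi]
        exact measurable_const
    · intro i ω
      by_cases hi : 1 ≤ i ∧ i ≤ n
      · simp only [hYdef, if_pos hi, hg1]
      · simp [hYdef, if_neg hi]
    · intro i
      by_cases hi : 1 ≤ i ∧ i ≤ n
      · simp only [hYdef, if_pos hi, hg0 i hi.1]
      · simp [hYdef, if_neg hi]
    · intro i
      by_cases hi : 1 ≤ i ∧ i ≤ n
      · simp only [hYdef, if_pos hi, hgδ i hi.1]
      · simp [hYdef, if_neg hi, hδ]
  have hsum : ∀ ω, ∑ i ∈ Finset.Icc 1 n, g (X i ω) = ∑ i ∈ Finset.range n, Y (i + 1) ω := by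
    intro ω
    rw [Finset.range_eq_Ico, Finset.sum_Ico_add' (fun i => Y i ω) 0 n 1]
    refine Finset.sum_congr (by ext i; simp) fun i hi => ?_
    simp only [hYdef, if_pos (Finset.mem_Icc.1 hi)]
  have hSm : Measurable fun ω => ∑ i ∈ Finset.range n, Y (i + 1) ω :=
    Finset.measurable_fun_sum _ fun i _ => hY.measurable hX _
  have hSn : ∀ ω, ∑ i ∈ Finset.range n, Y (i + 1) ω ≤ n := fun ω => by
    refine (Finset.sum_le_sum fun i _ => (le_abs_self _).trans (hY.abs_le_one _ ω)).trans ?_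
    simp
  simp_rw [hsum]
  have hint : Integrable (fun ω => Real.exp (c * ∑ i ∈ Finset.range n, Y (i + 1) ω)) μ :=
    integrable_of_abs_le (C := Real.exp (c * n)) (hSm.const_mul c).exp fun ω => by
      rw [Real.abs_exp]
      exact Real.exp_le_exp.2 (mul_le_mul_of_nonneg_left (hSn ω) hc0)
  refine (ProbabilityTheory.measure_ge_le_exp_mul_mgf t hc0 hint).trans ?_
  have hYn : ∀ i, n < i → Y i = 0 := fun i hi => by
    ext ω
    simp only [hYdef, if_neg (show ¬ (1 ≤ i ∧ i ≤ n) by omega), Pi.zero_apply]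
  calc _ ≤ Real.exp (-c * t) * (C * Real.exp (C * c ^ 2 * δ * n)) :=
        mul_le_mul_of_nonneg_left (h n hn δ Y hY hYn c hc0 hc) (Real.exp_pos _).le
    _ = _ := by
        rw [mul_left_comm, ← Real.exp_add]
        ring_nf

lemma exists_tail_indicator_le [IsProbabilityMeasure μ] (hX : ∀ i, Measurable (X i))
    (hphi : (fun n : ℕ => phiCoef X μ n) =O[atTop] fun n : ℕ => ((n : ℝ) ^ 3)⁻¹) :
    ∃ C : ℝ, 0 < C ∧ ∀ (n : ℕ), 16 ≤ n → ∀ (S : Set ℝ) (m : ℝ), MeasurableSet S →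
      (∀ i, 1 ≤ i → μ.real {ω | X i ω ∈ S} = m) →
      ∀ c t : ℝ, 0 ≤ c → 4 * c * (n : ℝ) ^ (1 / 4 : ℝ) ≤ 1 →
      μ.real {ω | t ≤ |∑ i ∈ Finset.Icc 1 n, S.indicator (1 : ℝ → ℝ) (X i ω) - n * m|} ≤
        C * Real.exp (C * c ^ 2 * m * n - c * t) := by
  obtain ⟨C, hC, h⟩ := exists_tail_le hX hphi
  refine ⟨2 * C, by positivity, fun n hn S m hS hm c t hc0 hc => ?_⟩
  have hm0 : 0 ≤ m := hm 1 le_rfl ▸ measureReal_nonneg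
  have hm1 : m ≤ 1 := hm 1 le_rfl ▸ measureReal_le_one
  set g : ℝ → ℝ := fun x => S.indicator (1 : ℝ → ℝ) x - m with hgdef
  have hg : Measurable g := (measurable_one.indicator hS).sub measurable_const
  have hind : ∀ x, 0 ≤ S.indicator (1 : ℝ → ℝ) x ∧ S.indicator (1 : ℝ → ℝ) x ≤ 1 := fun x => by
    by_cases hx : x ∈ S <;> simp [hx]
  have hg1 : ∀ x, |g x| ≤ 1 := fun x => by
    rw [abs_le]
    constructor <;> linarith [hind x]
  have hi : ∀ i, Integrable (fun ω => S.indicator (1 : ℝ → ℝ) (X i ω)) μ := fun i =>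
    integrable_of_abs_le (C := 1) ((measurable_one.indicator hS).comp (hX i)) fun ω => by
      rw [abs_of_nonneg (hind _).1]
      exact (hind _).2
  have hE : ∀ i, 1 ≤ i → ∫ ω, S.indicator (1 : ℝ → ℝ) (X i ω) ∂μ = m := fun i h1 => by
    rw [← hm i h1]
    exact integral_indicator_one (hX i hS)
  have hg0 : ∀ i, 1 ≤ i → ∫ ω, g (X i ω) ∂μ = 0 := fun i h1 => by
    simp only [hgdef]
    rw [integral_sub (hi i) (integrable_const _), hE i h1]
    simp
  have hgδ : ∀ i, 1 ≤ i → ∫ ω, |g (X i ω)| ∂μ ≤ 2 * m := fun i h1 => by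
    calc ∫ ω, |g (X i ω)| ∂μ ≤ ∫ ω, S.indicator (1 : ℝ → ℝ) (X i ω) + m ∂μ := by
          refine integral_mono (integrable_of_abs_le (hg.comp (hX i)) fun ω => hg1 _).abs
            ((hi i).add (integrable_const _)) fun ω => ?_
          simp only [hgdef]
          rw [abs_le]
          constructor <;> linarith [hind (X i ω)]
      _ = 2 * m := by
          rw [integral_add (hi i) (integrable_const _), hE i h1]
          simp only [integral_const, probReal_univ, smul_eq_mul, one_mul]
          ring
  have h1 := h n hn (2 * m) g hg hg1 hg0 hgδ c t hc0 hc
  have h2 := h n hn (2 * m) (fun x => -g x) hg.neg (fun x => by rw [abs_neg]; exact hg1 x)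
    (fun i h1 => by rw [integral_neg, hg0 i h1, neg_zero])
    (fun i h1 => by simpa only [abs_neg] using hgδ i h1) c t hc0 hc
  have hsum : ∀ ω, ∑ i ∈ Finset.Icc 1 n, g (X i ω) =
      ∑ i ∈ Finset.Icc 1 n, S.indicator (1 : ℝ → ℝ) (X i ω) - n * m := fun ω => by
    simp [hgdef, Finset.sum_sub_distrib]
  have hsub : {ω | t ≤ |∑ i ∈ Finset.Icc 1 n, S.indicator (1 : ℝ → ℝ) (X i ω) - n * m|} ⊆
      {ω | t ≤ ∑ i ∈ Finset.Icc 1 n, g (X i ω)} ∪ {ω | t ≤ ∑ i ∈ Finset.Icc 1 n, -g (X i ω)} := by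
    intro ω hω
    simp only [mem_ofPred_eq, ← hsum, le_abs] at hω
    simpa only [mem_union, mem_ofPred_eq, Finset.sum_neg_distrib] using hω
  calc _ ≤ _ := measureReal_mono hsub
    _ ≤ _ := measureReal_union_le _ _
    _ ≤ _ := add_le_add h1 h2
    _ = _ := by ring_nf

end Tail

section EmpiricalProcess

variable {Ω : Type*} [m0 : MeasurableSpace Ω] {μ : Measure Ω} {X : ℕ → Ω → ℝ} {F : ℝ → ℝ}

lemma monotone_empDF {Ω : Type*} (X : ℕ → Ω → ℝ) (n : ℕ) (ω : Ω) : Monotone (empDF X n ω) := by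
  intro x y hxy
  refine mul_le_mul_of_nonneg_left (Finset.sum_le_sum fun i _ => ?_) (by positivity)
  split_ifs with h1 h2
  · exact le_rfl
  · exact absurd (h1.trans hxy) h2
  · exact zero_le_one
  · exact le_rfl

lemma mul_empDF {Ω : Type*} (X : ℕ → Ω → ℝ) {n : ℕ} (hn : n ≠ 0) (ω : Ω) (x : ℝ) :
    n * empDF X n ω x = ∑ i ∈ Finset.Icc 1 n, (Iic x).indicator (1 : ℝ → ℝ) (X i ω) := by
  rw [empDF, mul_inv_cancel_left₀ (by exact_mod_cast hn)]
  refine Finset.sum_congr rfl fun i _ => ?_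
  simp [indicator_apply]

lemma exists_tail_empDF_le [IsProbabilityMeasure μ] (hX : ∀ i, Measurable (X i))
    (hphi : (fun n : ℕ => phiCoef X μ n) =O[atTop] fun n : ℕ => ((n : ℝ) ^ 3)⁻¹)
    (hF : ∀ i, 1 ≤ i → ∀ x, F x = (μ {ω | X i ω ≤ x}).toReal) :
    ∃ C : ℝ, 0 < C ∧ ∀ (n : ℕ), 16 ≤ n → ∀ x c t : ℝ, 0 ≤ c →
      4 * c * (n : ℝ) ^ (1 / 4 : ℝ) ≤ 1 →
      μ.real {ω | t ≤ |n * (empDF X n ω x - F x)|} ≤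
        C * Real.exp (C * c ^ 2 * n - c * t) := by
  obtain ⟨C, hC, h⟩ := exists_tail_indicator_le hX hphi
  refine ⟨C, hC, fun n hn x c t hc0 hc => ?_⟩
  have h1 := h n hn (Iic x) (F x) measurableSet_Iic (fun i hi => (hF i hi x).symm) c t hc0 hc
  simp_rw [mul_sub, mul_empDF X (show n ≠ 0 by omega)]
  refine h1.trans ?_
  have hF1 : F x ≤ 1 := hF 1 le_rfl x ▸ measureReal_le_one
  have h2 : C * c ^ 2 * F x * n ≤ C * c ^ 2 * n :=
    mul_le_mul_of_nonneg_right (mul_le_of_le_one_right (by positivity) hF1) n.cast_nonneg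
  exact mul_le_mul_of_nonneg_left (Real.exp_le_exp.2 (sub_le_sub_right h2 _)) hC.le

lemma exists_tail_empDF_increment_le [IsProbabilityMeasure μ] (hX : ∀ i, Measurable (X i))
    (hphi : (fun n : ℕ => phiCoef X μ n) =O[atTop] fun n : ℕ => ((n : ℝ) ^ 3)⁻¹)
    (hF : ∀ i, 1 ≤ i → ∀ x, F x = (μ {ω | X i ω ≤ x}).toReal) :
    ∃ C : ℝ, 0 < C ∧ ∀ (n : ℕ), 16 ≤ n → ∀ x y c t : ℝ, 0 ≤ c →
      4 * c * (n : ℝ) ^ (1 / 4 : ℝ) ≤ 1 →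
      μ.real {ω | t ≤ |n * ((empDF X n ω y - F y) - (empDF X n ω x - F x))|} ≤
        C * Real.exp (C * c ^ 2 * |F y - F x| * n - c * t) := by
  obtain ⟨C, hC, h⟩ := exists_tail_indicator_le hX hphi
  refine ⟨C, hC, fun n hn x y c t hc0 hc => ?_⟩
  wlog hxy : x ≤ y generalizing x y
  · have := this y x (le_of_not_ge hxy)
    rw [abs_sub_comm (F x)] at this
    refine le_trans (le_of_eq ?_) this
    congr 1
    ext ω
    simp only [mem_ofPred_eq]
    rw [← abs_neg]
    ring_nf
  have hm : ∀ i, 1 ≤ i → μ.real {ω | X i ω ∈ Ioc x y} = F y - F x := fun i hi => by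
    have hd : {ω | X i ω ∈ Ioc x y} = {ω | X i ω ≤ y} \ {ω | X i ω ≤ x} := by
      ext ω
      simp [and_comm]
    have hsub : {ω | X i ω ≤ x} ⊆ {ω | X i ω ≤ y} := fun ω (hω : X i ω ≤ x) => hω.trans hxy
    rw [hd, measureReal_sdiff hsub (hX i measurableSet_Iic), hF i hi, hF i hi]
    rfl
  have hm0 : 0 ≤ F y - F x := hm 1 le_rfl ▸ measureReal_nonneg
  rw [abs_of_nonneg hm0]
  have hind : ∀ z, (Ioc x y).indicator (1 : ℝ → ℝ) z =
      (Iic y).indicator 1 z - (Iic x).indicator 1 z := fun z => by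
    rcases le_or_gt z x with h1 | h1
    · simp [h1, h1.trans hxy, not_lt.2 h1]
    · simp [indicator_apply, h1, not_le.2 h1]
  refine le_trans (le_of_eq ?_) (h n hn (Ioc x y) (F y - F x) measurableSet_Ioc hm c t hc0 hc)
  congr 1
  ext ω
  have hn0 : n ≠ 0 := by omega
  simp only [mem_ofPred_eq, hind, Finset.sum_sub_distrib, ← mul_empDF X hn0 ω]
  ring_nf

lemma ae_eventually_notMem_of_measureReal_le [IsFiniteMeasure μ] {s : ℕ → Set Ω} {B : ℝ}
    (h : ∀ᶠ n : ℕ in atTop, μ.real (s n) ≤ B * ((n : ℝ) ^ 2)⁻¹) :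
    ∀ᵐ ω ∂μ, ∀ᶠ n in atTop, ω ∉ s n := by
  have hs : Summable fun n => μ.real (s n) :=
    Summable.of_norm_bounded_eventually_nat
      ((Real.summable_nat_pow_inv.2 (by norm_num : 1 < 2)).mul_left B)
      (h.mono fun n hn => by rwa [Real.norm_of_nonneg measureReal_nonneg])
  refine ae_eventually_notMem ?_
  have := hs.tsum_ofReal_ne_top
  simpa only [Measure.real, ENNReal.ofReal_toReal (measure_ne_top μ _)] using this

lemma rpow_quarter_pow_four (n : ℕ) : ((n : ℝ) ^ (1 / 4 : ℝ)) ^ 4 = n := by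
  rw [← Real.rpow_natCast, ← Real.rpow_mul (by positivity)]
  norm_num

lemma tendsto_rpow_quarter : Tendsto (fun n : ℕ => (n : ℝ) ^ (1 / 4 : ℝ)) atTop atTop :=
  (tendsto_rpow_atTop (by norm_num)).comp tendsto_natCast_atTop_atTop

lemma exp_neg_natCast_mul_log (k : ℕ) {n : ℕ} (hn : n ≠ 0) :
    Real.exp (-(k * Real.log n)) = ((n : ℝ) ^ k)⁻¹ := by
  rw [Real.exp_neg, Real.exp_nat_mul, Real.exp_log (by positivity)]

lemma ae_eventually_abs_empDF_sub_lt [IsProbabilityMeasure μ] (hX : ∀ i, Measurable (X i))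
    (hphi : (fun n : ℕ => phiCoef X μ n) =O[atTop] fun n : ℕ => ((n : ℝ) ^ 3)⁻¹)
    (hF : ∀ i, 1 ≤ i → ∀ x, F x = (μ {ω | X i ω ≤ x}).toReal) (x : ℕ → ℝ) :
    ∀ᵐ ω ∂μ, ∀ᶠ n : ℕ in atTop, |n * (empDF X n ω (x n) - F (x n))| <
      2 * ((n : ℝ) ^ (1 / 4 : ℝ)) ^ 2 * Real.log n := by
  obtain ⟨C, hC, h⟩ := exists_tail_empDF_le hX hphi hF
  have key := ae_eventually_notMem_of_measureReal_le (μ := μ) (B := C * Real.exp C)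
    (s := fun n => {ω | 2 * ((n : ℝ) ^ (1 / 4 : ℝ)) ^ 2 * Real.log n ≤
      |n * (empDF X n ω (x n) - F (x n))|}) ?_
  · filter_upwards [key] with ω hω
    filter_upwards [hω] with n hn
    simpa using hn
  filter_upwards [eventually_ge_atTop 16, tendsto_rpow_quarter.eventually_ge_atTop 4] with n hn hu
  have hu4 := rpow_quarter_pow_four n
  set u : ℝ := (n : ℝ) ^ (1 / 4 : ℝ) with hudef
  have hu0 : 0 < u := by linarith
  refine (h n hn (x n) (u ^ 2)⁻¹ _ (by positivity) ?_).trans (le_of_eq ?_)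
  · have : 4 * (u ^ 2)⁻¹ * u = 4 / u := by field_simp
    rw [this]
    exact (div_le_one hu0).2 hu
  · rw [mul_assoc C (Real.exp C), ← exp_neg_natCast_mul_log 2 (by omega), ← Real.exp_add, ← hu4]
    congr 2
    rw [hu4]
    have h1 : C * (u ^ 2)⁻¹ ^ 2 * n = C := by
      rw [← hu4]
      field_simp
    rw [h1]
    field_simp
    push_cast
    ring

lemma exists_ae_eventually_increment_lt [IsProbabilityMeasure μ] (hX : ∀ i, Measurable (X i))
    (hphi : (fun n : ℕ => phiCoef X μ n) =O[atTop] fun n : ℕ => ((n : ℝ) ^ 3)⁻¹)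
    (hF : ∀ i, 1 ≤ i → ∀ x, F x = (μ {ω | X i ω ≤ x}).toReal) {ξ : ℝ} {x : ℕ → ℕ → ℝ} {D : ℝ}
    (hx : ∀ᶠ n : ℕ in atTop, ∀ r ≤ n, |F (x n r) - F ξ| ≤
      D * Real.log n / ((n : ℝ) ^ (1 / 4 : ℝ)) ^ 2) :
    ∃ E : ℝ, ∀ᵐ ω ∂μ, ∀ᶠ n : ℕ in atTop, ∀ r ≤ n,
      |n * ((empDF X n ω (x n r) - F (x n r)) - (empDF X n ω ξ - F ξ))| <
        E * (n : ℝ) ^ (1 / 4 : ℝ) * Real.log n := by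
  obtain ⟨C, hC, h⟩ := exists_tail_empDF_increment_le hX hphi hF
  refine ⟨C * D / 4 + 12, ?_⟩
  have key := ae_eventually_notMem_of_measureReal_le (μ := μ) (B := 2 * C)
    (s := fun n => ⋃ r ∈ Finset.range (n + 1),
      {ω | (C * D / 4 + 12) * (n : ℝ) ^ (1 / 4 : ℝ) * Real.log n ≤
      |n * ((empDF X n ω (x n r) - F (x n r)) - (empDF X n ω ξ - F ξ))|}) ?_
  · filter_upwards [key] with ω hω
    filter_upwards [hω] with n hn r hr
    simp only [mem_iUnion, not_exists, Finset.mem_range, Nat.lt_succ_iff] at hn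
    simpa using hn r hr
  filter_upwards [eventually_ge_atTop 16, tendsto_rpow_quarter.eventually_ge_atTop 1, hx]
    with n hn hu hxn
  have hu4 := rpow_quarter_pow_four n
  set u : ℝ := (n : ℝ) ^ (1 / 4 : ℝ) with hudef
  have hu0 : 0 < u := by linarith
  have hn0 : (0 : ℝ) < n := by positivity
  have hn1 : (1 : ℝ) ≤ n := by exact_mod_cast (by omega : 1 ≤ n)
  have hpt : ∀ r ∈ Finset.range (n + 1),
      μ.real {ω | (C * D / 4 + 12) * u * Real.log n ≤
        |n * ((empDF X n ω (x n r) - F (x n r)) - (empDF X n ω ξ - F ξ))|} ≤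
      C * ((n : ℝ) ^ 3)⁻¹ := by
    intro r hr
    have hr' : r ≤ n := Nat.lt_succ_iff.1 (Finset.mem_range.1 hr)
    refine (h n hn ξ (x n r) (4 * u)⁻¹ _ (by positivity) ?_).trans ?_
    · have : 4 * (4 * u)⁻¹ * u = 1 := by field_simp
      exact this.le
    · rw [← exp_neg_natCast_mul_log 3 (by omega)]
      refine mul_le_mul_of_nonneg_left (Real.exp_le_exp.2 ?_) hC.le
      have h1 : C * (4 * u)⁻¹ ^ 2 * |F (x n r) - F ξ| * n ≤
          C * (4 * u)⁻¹ ^ 2 * (D * Real.log n / u ^ 2) * n := by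
        gcongr
        exact hxn r hr'
      have h2 : C * (4 * u)⁻¹ ^ 2 * (D * Real.log n / u ^ 2) * n = C * D / 16 * Real.log n := by
        rw [show C * (4 * u)⁻¹ ^ 2 * (D * Real.log n / u ^ 2) * n =
          C * D / 16 * Real.log n * (n / u ^ 4) by field_simp; ring, hu4, div_self hn0.ne', mul_one]
      have h3 : (4 * u)⁻¹ * ((C * D / 4 + 12) * u * Real.log n) =
          (C * D / 16 + 3) * Real.log n := by
        field_simp
        ring
      push_cast
      linarith
  refine (measureReal_biUnion_finset_le _ _).trans ((Finset.sum_le_sum hpt).trans ?_)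
  rw [Finset.sum_const, Finset.card_range, nsmul_eq_mul]
  push_cast
  calc ((n : ℝ) + 1) * (C * ((n : ℝ) ^ 3)⁻¹) ≤ (2 * n) * (C * ((n : ℝ) ^ 3)⁻¹) := by
        gcongr
        linarith
    _ = 2 * C * ((n : ℝ) ^ 2)⁻¹ := by
        field_simp

end EmpiricalProcess

lemma quantile_mem_Icc {H : ℝ → ℝ} (hH : Monotone H) {p b c : ℝ} (hb : H b < p) (hc : p ≤ H c) :
    quantile H p ∈ Icc b c := by
  have hlb : ∀ x ∈ {x : ℝ | p ≤ H x}, b ≤ x := fun x (hx : p ≤ H x) => by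
    by_contra! hlt
    exact absurd (hx.trans (hH hlt.le)) (not_le.2 hb)
  exact ⟨le_csInf ⟨c, hc⟩ hlb, csInf_le ⟨b, hlb⟩ hc⟩

lemma apply_quantile_eq {F : ℝ → ℝ} {p : ℝ} (hF : Monotone F) (hbot : ∃ x, F x < p)
    (htop : ∃ x, p ≤ F x) (hc : ContinuousAt F (quantile F p)) : F (quantile F p) = p := by
  obtain ⟨b, hb⟩ := hbot
  obtain ⟨c, hpc⟩ := htop
  have hlb : BddBelow {x : ℝ | p ≤ F x} := ⟨b, fun x (hx : p ≤ F x) => by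
    by_contra! hlt
    exact absurd (hx.trans (hF hlt.le)) (not_le.2 hb)⟩
  apply le_antisymm
  · refine le_of_tendsto (hc.tendsto.mono_left (nhdsWithin_le_nhds (s := Iio (quantile F p)))) ?_
    filter_upwards [self_mem_nhdsWithin] with x hx
    by_contra! hlt
    exact absurd (csInf_le hlb hlt.le) (not_le.2 hx)
  · refine ge_of_tendsto (hc.tendsto.mono_left (nhdsWithin_le_nhds (s := Ioi (quantile F p)))) ?_
    filter_upwards [self_mem_nhdsWithin] with x hx
    obtain ⟨y, hy, hyx⟩ := exists_lt_of_csInf_lt ⟨c, hpc⟩ hx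
    exact le_trans hy (hF hyx.le)

lemma abs_sub_le_of_grid {H F : ℝ → ℝ} (hH : Monotone H) {ξ a e d : ℝ}
    (ha : 0 < a) (hd : 0 ≤ d) {n : ℕ} (hn : n ≠ 0)
    (hgrid : ∀ r ≤ n, |(H (ξ - a + r * (2 * a / n)) - F (ξ - a + r * (2 * a / n))) -
      (H ξ - F ξ)| ≤ e)
    (hinc : ∀ x ∈ Icc (ξ - a) (ξ + a), ∀ y ∈ Icc (ξ - a) (ξ + a), x ≤ y →
      F y - F x ≤ d * (y - x)) {x : ℝ} (hx : x ∈ Icc (ξ - a) (ξ + a)) :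
    |(H x - F x) - (H ξ - F ξ)| ≤ e + d * (2 * a / n) := by
  have hn0 : (0 : ℝ) < n := by positivity
  set w := 2 * a / n with hw
  have hw0 : 0 < w := by positivity
  have hwn : n * w = 2 * a := by rw [hw]; field_simp
  set z := (x - (ξ - a)) / w with hz
  have hzw : z * w = x - (ξ - a) := by rw [hz]; field_simp
  have hz0 : 0 ≤ z := div_nonneg (by linarith [hx.1]) hw0.le
  have hzn : z ≤ n := by
    rw [hz, div_le_iff₀ hw0, hwn]
    linarith [hx.2]
  have hfl : (⌊z⌋₊ : ℝ) ≤ z := Nat.floor_le hz0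
  have hcl : z ≤ ⌈z⌉₊ := Nat.le_ceil z
  have hcn : ⌈z⌉₊ ≤ n := Nat.ceil_le.2 hzn
  have hfn : ⌊z⌋₊ ≤ n := (Nat.floor_le_ceil z).trans hcn
  have hcn' : (⌈z⌉₊ : ℝ) ≤ n := by exact_mod_cast hcn
  have hf1 : z < ⌊z⌋₊ + 1 := Nat.lt_floor_add_one z
  have hc1 : (⌈z⌉₊ : ℝ) < z + 1 := Nat.ceil_lt_add_one hz0
  have gl := (abs_le.1 (hgrid _ hfn)).1
  have gu := (abs_le.1 (hgrid _ hcn)).2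
  set xl := ξ - a + ⌊z⌋₊ * w with hxl
  set xu := ξ - a + ⌈z⌉₊ * w with hxu
  have hlx : xl ≤ x := by nlinarith
  have hxu' : x ≤ xu := by nlinarith
  have hl : xl ∈ Icc (ξ - a) (ξ + a) := ⟨by rw [hxl]; nlinarith [Nat.cast_nonneg (α := ℝ) ⌊z⌋₊],
    hlx.trans hx.2⟩
  have hu : xu ∈ Icc (ξ - a) (ξ + a) := ⟨hx.1.trans hxu', by rw [hxu]; nlinarith⟩
  have il := hinc xl hl x hx hlx
  have iu := hinc x hx xu hu hxu'
  have il' : d * (x - xl) ≤ d * w := mul_le_mul_of_nonneg_left (by nlinarith) hd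
  have iu' : d * (xu - x) ≤ d * w := mul_le_mul_of_nonneg_left (by nlinarith) hd
  rw [abs_le]
  constructor
  · linarith [hH hlx]
  · linarith [hH hxu']

lemma tendsto_log_div_rpow_quarter_sq :
    Tendsto (fun n : ℕ => Real.log n / ((n : ℝ) ^ (1 / 4 : ℝ)) ^ 2) atTop (nhds 0) := by
  have h := ((isLittleO_log_rpow_atTop (r := 1 / 2) (by norm_num)).tendsto_div_nhds_zero).comp
    (tendsto_natCast_atTop_atTop (R := ℝ))
  refine h.congr fun n => ?_
  simp only [Function.comp_apply]
  rw [← Real.rpow_natCast ((n : ℝ) ^ (1 / 4 : ℝ)) 2, ← Real.rpow_mul (by positivity)]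
  norm_num

/-- For a φ-mixing sequence with `φ(n) = O(n⁻³)`, `P(X_i = X_j) = 0` for `i ≠ j`,
and a marginal distribution function `F` with positive continuous density `f`
near `ξ_p` (with bounded `f'` there), with probability 1,
`F_n(ξ_p) - p = F_n(ξ_{p,n}) - F(ξ_{p,n}) + O(n^{-3/4} log n)` as `n → ∞`. -/
theorem bahadur_centered_at_sample_quantile {Ω : Type*} [MeasurableSpace Ω] (μ : Measure Ω)
    [IsProbabilityMeasure μ]
    (X : ℕ → Ω → ℝ) (hX : ∀ i, Measurable (X i))
    (hanti : Antitone (phiCoef X μ))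
    (hmix : Tendsto (phiCoef X μ) atTop (nhds 0))
    (hphi : (fun n : ℕ => phiCoef X μ n) =O[atTop] fun n : ℕ => ((n : ℝ) ^ 3)⁻¹)
    (hdist : ∀ i j, 1 ≤ i → 1 ≤ j → i ≠ j → μ {ω | X i ω = X j ω} = 0)
    (F : ℝ → ℝ) (hF : ∀ i, 1 ≤ i → ∀ x, F x = (μ {ω | X i ω ≤ x}).toReal)
    (p : ℝ) (hp : 0 < p ∧ p < 1)
    (Np : Set ℝ) (hNp : Np ∈ nhds (quantile F p))
    (f : ℝ → ℝ) (hfc : ContinuousOn f Np) (hfpos : ∀ x ∈ Np, 0 < f x)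
    (hFf : ∀ x ∈ Np, HasDerivAt F (f x) x)
    (d : ℝ) (hd : IsLUB (f '' Np) d) (hd0 : 0 < d)
    (f' : ℝ → ℝ) (hff' : ∀ x ∈ Np, HasDerivAt f (f' x) x)
    (hf'bdd : ∃ M : ℝ, ∀ x ∈ Np, |f' x| ≤ M) :
    ∀ᵐ ω ∂μ,
      (fun n : ℕ => (empDF X n ω (quantile F p) - p) -
          (empDF X n ω (sampleQuantile X n ω p) - F (sampleQuantile X n ω p)))
        =O[atTop] fun n : ℕ => (n : ℝ) ^ (-(3 : ℝ) / 4) * Real.log n := by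

  set ξ := quantile F p with hξ
  have hFmono : Monotone F := fun x y hxy => by
    rw [hF 1 le_rfl, hF 1 le_rfl]
    exact measureReal_mono fun ω (hω : X 1 ω ≤ x) => hω.trans hxy
  have hFcdf : ∀ x, F x = ProbabilityTheory.cdf (μ.map (X 1)) x := fun x => by
    have := Measure.isProbabilityMeasure_map (μ := μ) (hX 1).aemeasurable
    rw [ProbabilityTheory.cdf_eq_real, map_measureReal_apply (hX 1) measurableSet_Iic, hF 1 le_rfl]
    rfl
  have hξNp : ξ ∈ Np := mem_of_mem_nhds hNp
  have hFξ : F ξ = p := by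
    refine apply_quantile_eq hFmono ?_ ?_ (hFf ξ hξNp).continuousAt
    · simp_rw [hFcdf]
      exact ((ProbabilityTheory.tendsto_cdf_atBot _).eventually_lt_const hp.1).exists
    · simp_rw [hFcdf]
      exact ((ProbabilityTheory.tendsto_cdf_atTop _).eventually_const_le hp.2).exists
  have hfξ : 0 < f ξ := hfpos ξ hξNp
  obtain ⟨ε, hε, hball⟩ := Metric.mem_nhds_iff.1 hNp
  have hder := (hasDerivAt_iff_isLittleO.1 (hFf ξ hξNp)).def (c := f ξ / 2) (by positivity)
  obtain ⟨ε', hε', hder'⟩ := Metric.eventually_nhds_iff.1 hder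
  have hlip : ∀ x ∈ Metric.ball ξ ε, ∀ y ∈ Metric.ball ξ ε, x ≤ y → F y - F x ≤ d * (y - x) := by
    refine (convex_ball ξ ε).image_sub_le_mul_sub_of_deriv_le
      (fun x hx => (hFf x (hball hx)).continuousAt.continuousWithinAt)
      (fun x hx => (hFf x (hball (interior_subset hx))).differentiableAt.differentiableWithinAt)
      fun x hx => ?_
    have hx' := hball (interior_subset hx)
    rw [(hFf x hx').deriv]
    exact hd.1 (mem_image_of_mem f hx')
  set K := 4 / f ξ with hK
  have hK0 : 0 < K := by positivity
  set u : ℕ → ℝ := fun n => (n : ℝ) ^ (1 / 4 : ℝ) with hu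
  set a : ℕ → ℝ := fun n => K * (Real.log n / u n ^ 2) with ha
  have ha_lim : Tendsto a atTop (nhds 0) := by
    simpa only [mul_zero] using tendsto_log_div_rpow_quarter_sq.const_mul K
  have ha_small : ∀ᶠ n in atTop, a n < min ε ε' :=
    ha_lim.eventually_lt_const (lt_min hε hε')
  have ha_pos : ∀ n : ℕ, 2 ≤ n → 0 < a n := fun n hn => by
    have : 0 < Real.log n := Real.log_pos (by exact_mod_cast hn)
    have : 0 < u n := by positivity
    positivity
  have hIcc : ∀ n, a n < min ε ε' → ∀ x ∈ Icc (ξ - a n) (ξ + a n), x ∈ Metric.ball ξ ε :=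
    fun n hn x hx => by
      rw [Metric.mem_ball, Real.dist_eq, abs_lt]
      constructor <;> linarith [hx.1, hx.2, min_le_left ε ε']
  have hgrid_mem : ∀ n : ℕ, 2 ≤ n → ∀ r : ℕ, r ≤ n →
      ξ - a n + r * (2 * a n / n) ∈ Icc (ξ - a n) (ξ + a n) := fun n hn r hr => by
    have h0 := ha_pos n hn
    have hn0 : (0 : ℝ) < n := by positivity
    have hrn : (r : ℝ) ≤ n := by exact_mod_cast hr
    have h1 : (r : ℝ) * (2 * a n / n) ≤ n * (2 * a n / n) := by gcongr
    rw [mul_div_cancel₀ _ hn0.ne'] at h1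
    have h2 : 0 ≤ (r : ℝ) * (2 * a n / n) := by positivity
    constructor <;> linarith
  have hgrid_inc : ∀ᶠ n : ℕ in atTop, ∀ r ≤ n,
      |F (ξ - a n + r * (2 * a n / n)) - F ξ| ≤ d * K * Real.log n / u n ^ 2 := by
    filter_upwards [ha_small, eventually_ge_atTop 2] with n hn hn2 r hr
    have hm := hgrid_mem n hn2 r hr
    have h0 := ha_pos n hn2
    have hξm := Metric.mem_ball_self (x := ξ) hε
    set y := ξ - a n + r * (2 * a n / n)
    have hda : d * a n = d * K * Real.log n / u n ^ 2 := by rw [ha]; ring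
    rw [← hda]
    rcases le_total ξ y with h | h
    · rw [abs_of_nonneg (by linarith [hFmono h])]
      exact (hlip ξ hξm y (hIcc n hn y hm) h).trans
        (mul_le_mul_of_nonneg_left (by linarith [hm.2]) hd0.le)
    · rw [abs_of_nonpos (by linarith [hFmono h]), neg_sub]
      exact (hlip y (hIcc n hn y hm) ξ hξm h).trans
        (mul_le_mul_of_nonneg_left (by linarith [hm.1]) hd0.le)
  obtain ⟨E, hE⟩ := exists_ae_eventually_increment_lt hX hphi hF hgrid_inc
  filter_upwards [hE, ae_eventually_abs_empDF_sub_lt hX hphi hF fun n => ξ + a n,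
    ae_eventually_abs_empDF_sub_lt hX hphi hF fun n => ξ - a n] with ω h1 h2 h3
  refine Asymptotics.IsBigO.of_bound (|E| + 2 * d * K) ?_
  filter_upwards [h1, h2, h3, ha_small, eventually_ge_atTop 2,
    tendsto_rpow_quarter.eventually_ge_atTop 1] with n g1 g2 g3 hn hn2 hu1
  have hu4 : u n ^ 4 = n := rpow_quarter_pow_four n
  change 1 ≤ u n at hu1
  change ∀ r ≤ n, _ < E * u n * Real.log n at g1
  change _ < 2 * u n ^ 2 * Real.log n at g2
  change _ < 2 * u n ^ 2 * Real.log n at g3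
  have hu0 : 0 < u n := by linarith
  have hn0 : (0 : ℝ) < n := by positivity
  have hL : 0 < Real.log n := Real.log_pos (by exact_mod_cast hn2)
  have h0 := ha_pos n hn2
  have hκ : f ξ / 2 * a n = 2 * Real.log n / u n ^ 2 := by
    simp only [ha, hK]
    field_simp
    norm_num
  have hb : n * (f ξ / 2 * a n) = 2 * u n ^ 2 * Real.log n := by
    rw [hκ, ← hu4]
    field_simp
  rw [← hb, abs_mul, abs_of_pos hn0, mul_lt_mul_iff_right₀ hn0, abs_lt] at g2 g3
  have hup : p + f ξ / 2 * a n ≤ F (ξ + a n) := by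
    have := hder' (y := ξ + a n) (by
      rw [Real.dist_eq, add_sub_cancel_left, abs_of_pos h0]
      exact hn.trans_le (min_le_right _ _))
    rw [add_sub_cancel_left, hFξ, smul_eq_mul, Real.norm_eq_abs, Real.norm_of_nonneg h0.le] at this
    linarith [(abs_le.1 this).1]
  have hdown : F (ξ - a n) ≤ p - f ξ / 2 * a n := by
    have := hder' (y := ξ - a n) (by
      rw [Real.dist_eq, sub_sub_cancel_left, abs_neg, abs_of_pos h0]
      exact hn.trans_le (min_le_right _ _))
    rw [sub_sub_cancel_left, hFξ, smul_eq_mul, norm_neg, Real.norm_eq_abs,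
      Real.norm_of_nonneg h0.le] at this
    linarith [(abs_le.1 this).2]
  have hq : sampleQuantile X n ω p ∈ Icc (ξ - a n) (ξ + a n) :=
    quantile_mem_Icc (monotone_empDF X n ω) (by linarith [g3.2]) (by linarith [g2.1])
  have hfin := abs_sub_le_of_grid (monotone_empDF X n ω) h0 hd0.le (n := n) (by omega)
    (e := E * u n * Real.log n / n)
    (fun r hr => by
      have := (g1 r hr).le
      rwa [abs_mul, abs_of_pos hn0, mul_comm, ← le_div_iff₀ hn0] at this)
    (fun x hx y hy => hlip x (hIcc n hn x hx) y (hIcc n hn y hy)) hq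
  have hrate : (n : ℝ) ^ (-(3 : ℝ) / 4) = (u n ^ 3)⁻¹ := by
    simp only [hu]
    rw [← Real.rpow_natCast, ← Real.rpow_mul hn0.le, ← Real.rpow_neg hn0.le]
    norm_num
  rw [hrate, Real.norm_eq_abs, Real.norm_of_nonneg (by positivity)]
  rw [hFξ, abs_sub_comm] at hfin
  refine hfin.trans ?_
  have e1 : E * u n * Real.log n / n = E * ((u n ^ 3)⁻¹ * Real.log n) := by
    rw [← hu4]
    field_simp
  have e2 : d * (2 * a n / n) = 2 * d * K * ((u n ^ 6)⁻¹ * Real.log n) := by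
    simp only [ha]
    rw [← hu4]
    field_simp
  rw [e1, e2, add_mul]
  gcongr
  · exact le_abs_self E
  · norm_num
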